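/- Let m ≥ 2 and let A = A_q be the intensity matrix of the Pólya urn with the full type set 𝒮 (|𝒮| = q) decomposing the random m-ary search tree, with activities a_1 ≤ a_2 ≤ … (a_i = i for i ≤ m−1). Then the eigenvalues of A, counted with algebraic multiplicity, are exactly the m−1 roots of the polynomial φ_m(λ) := Π_{i=1}^{m−1}(λ + i) − m! together with the multiset {−a_i : i = m, m+1, …, q}. -/

import Mathlib

open scoped BigOperators

namespace UrnMST

/-- The marked ordered tree underlying an `m`-ary search tree: a node either holds
`j` keys and has no children (`lf j`, with `j ≤ m - 2`; `lf 0` is an external node),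
or is full, holding `m - 1` keys, and has `m` (possibly external) children. -/
inductive MTree (m : ℕ) : Type
  | lf : ℕ → MTree m
  | nd : (Fin m → MTree m) → MTree m

namespace MTree

/-- The number of gaps of a tree (the activity of the corresponding urn type):
a node holding `j ≤ m - 2` keys has `j + 1` gaps, full nodes have none. -/
def gaps {m : ℕ} : MTree m → ℕ
  | lf j => j + 1
  | nd c => ∑ i, gaps (c i)

/-- The list of all trees obtained by inserting one new key into one of the gaps of
the given tree (one entry for each gap). -/
def insertions {m : ℕ} : MTree m → List (MTree m)
  | lf j => List.replicate (j + 1) (if j + 2 < m then lf (j + 1) else nd (fun _ => lf 0))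
  | nd c => (List.finRange m).flatMap
      (fun i => (insertions (c i)).map (fun t => nd (Function.update c i t)))

end MTree

/-- `Grows m t t'` means that `t'` can be obtained from `t` by adding keys
(the partial order `⪯` on `m`-ary search trees). -/
def Grows (m : ℕ) : MTree m → MTree m → Prop :=
  Relation.ReflTransGen (fun a b => b ∈ MTree.insertions a)

open Classical in
/-- Decompose a tree with respect to the set `S` of living types (a node is living
if its fringe subtree lies in `S`, and descendants of living nodes are living), and
count the number of components of type `T`. -/
noncomputable def decompCount {m : ℕ} (S : Set (MTree m)) (T : MTree m) : MTree m → ℕ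
  | MTree.lf j => if MTree.lf j ∈ S ∧ MTree.lf j = T then 1 else 0
  | MTree.nd c => if MTree.nd c ∈ S then (if MTree.nd c = T then 1 else 0)
      else ∑ i, decompCount S T (c i)

/-- The intensity matrix `A_k = (a_j E ξ_{ji})_{i,j}` of the Pólya urn with types
`𝒮_k = {T_1, …, T_k}` (given by the enumeration `τ` of `𝒮 = 𝒮_q`): a ball of type
`T_j` is drawn with probability proportional to its activity `a_j = gaps T_j`, a new
key is inserted into a uniformly chosen gap of it, and the result is re-decomposed
with respect to `𝒮_k`; the drawn ball counts as removed. -/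
noncomputable def intensity {m q : ℕ} (τ : Fin q → MTree m) (k : ℕ) (hk : k ≤ q) :
    Matrix (Fin k) (Fin k) ℝ :=
  Matrix.of fun i j =>
    (((MTree.insertions (τ (Fin.castLE hk j))).map
        (fun t => (decompCount (Set.range fun s : Fin k => τ (Fin.castLE hk s))
          (τ (Fin.castLE hk i)) t : ℝ))).sum)
      - (if i = j then (MTree.gaps (τ (Fin.castLE hk j)) : ℝ) else 0)

/-- For `m = 2`: the left path with `n` internal nodes. -/
def leftPath (m : ℕ) : ℕ → MTree m
  | 0 => MTree.lf 0
  | n + 1 => MTree.nd (fun i => if (i : ℕ) = 0 then leftPath m n else MTree.lf 0)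

/-- For `m = 2`: the right path with `n` internal nodes. -/
def rightPath (m : ℕ) : ℕ → MTree m
  | 0 => MTree.lf 0
  | n + 1 => MTree.nd (fun i => if (i : ℕ) = m - 1 then rightPath m n else MTree.lf 0)

/-- `t` is the longest left path belonging to `S`. -/
def MaxLeft {m : ℕ} (S : Set (MTree m)) (t : MTree m) : Prop :=
  ∃ n, t = leftPath m n ∧ leftPath m n ∈ S ∧ leftPath m (n + 1) ∉ S

/-- `t` is the longest right path belonging to `S`. -/
def MaxRight {m : ℕ} (S : Set (MTree m)) (t : MTree m) : Prop :=
  ∃ n, t = rightPath m n ∧ rightPath m n ∈ S ∧ rightPath m (n + 1) ∉ S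

end UrnMST

namespace UrnMST

open Polynomial

namespace MTree

variable {m : ℕ}

/-- A weight on trees that strictly decreases when passing to a child, and strictly
increases when a key is inserted. -/
def weight : MTree m → ℕ
  | lf j => j
  | nd c => m + ∑ i, weight (c i)

theorem weight_child_lt (hm : 0 < m) (c : Fin m → MTree m) (i : Fin m) :
    weight (c i) < weight (nd c) := by
  have := Finset.single_le_sum (f := fun i => weight (c i)) (fun _ _ => Nat.zero_le _)
    (Finset.mem_univ i)
  simp only [weight] at this ⊢
  omega

theorem sum_map_insertions_nd {M : Type*} [AddCommMonoid M] (c : Fin m → MTree m)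
    (f : MTree m → M) :
    ((insertions (nd c)).map f).sum
      = ∑ i, ((insertions (c i)).map (fun t => f (nd (Function.update c i t)))).sum := by
  simp [insertions, List.flatMap, List.map_flatten, List.sum_flatten, Fin.sum_univ_def, Function.comp_def]

theorem mem_insertions_nd {c : Fin m → MTree m} {t : MTree m} :
    t ∈ insertions (nd c) ↔
      ∃ i, ∃ s ∈ insertions (c i), t = nd (Function.update c i s) := by
  simp [insertions, eq_comm]

theorem length_insertions (t : MTree m) : (insertions t).length = gaps t := by
  induction t with
  | lf j => simp [insertions, gaps]
  | nd c ih =>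
    simp [insertions, gaps, List.length_flatMap, ih, Fin.sum_univ_def]

end MTree

open MTree

section Reachable

variable {m : ℕ}

theorem Grows.insert {a b c : MTree m} (h : Grows m a b) (hc : c ∈ insertions b) :
    Grows m a c := Relation.ReflTransGen.tail h hc

theorem Grows.shape (hm : 2 ≤ m) {t : MTree m} (h : Grows m (lf 0) t) :
    (∃ j, t = lf j ∧ j + 2 ≤ m) ∨
      ∃ c, t = nd c ∧ (∀ i, Grows m (lf 0) (c i)) ∧ Grows m (nd fun _ => lf 0) (nd c) := by
  induction h with
  | refl => exact Or.inl ⟨0, rfl, hm⟩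
  | @tail b t _ ht ih =>
    obtain ⟨j, rfl, hj⟩ | ⟨c, rfl, hc, hg⟩ := ih
    · simp only [insertions] at ht
      have ht := List.eq_of_mem_replicate ht
      split_ifs at ht with hj2
      · exact Or.inl ⟨j + 1, ht, by omega⟩
      · exact Or.inr ⟨_, ht, fun _ => Relation.ReflTransGen.refl, Relation.ReflTransGen.refl⟩
    · have hgt := hg.insert ht
      obtain ⟨i, s, hs, rfl⟩ := mem_insertions_nd.1 ht
      refine Or.inr ⟨_, rfl, fun k => ?_, hgt⟩
      obtain rfl | hk := eq_or_ne k i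
      · simpa using (hc k).insert hs
      · simpa [hk] using hc k

theorem Grows.child (hm : 2 ≤ m) {c : Fin m → MTree m} (h : Grows m (lf 0) (nd c))
    (i : Fin m) : Grows m (lf 0) (c i) := by
  obtain ⟨j, hj, _⟩ | ⟨c', hc', hc, _⟩ := h.shape hm
  · cases hj
  · cases hc'
    exact hc i

theorem Grows.lf_le (hm : 2 ≤ m) {j : ℕ} (h : Grows m (lf 0) (lf j)) : j + 2 ≤ m := by
  obtain ⟨k, hk, hkm⟩ | ⟨c, hc, _⟩ := h.shape hm
  · cases hk
    exact hkm
  · cases hc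

theorem grows_lf_lf {i j : ℕ} (hij : i ≤ j) (hj : j + 2 ≤ m) : Grows m (lf i) (lf j) := by
  induction j, hij using Nat.le_induction with
  | base => exact Relation.ReflTransGen.refl
  | succ j _ ih =>
    refine (ih (by omega)).insert ?_
    simp [insertions, show j + 2 < m by omega]

theorem Grows.lf_nd (hm : 2 ≤ m) {j : ℕ} (hj : j + 2 ≤ m) {c : Fin m → MTree m}
    (h : Grows m (lf 0) (nd c)) : Grows m (lf j) (nd c) := by
  obtain ⟨k, hk, _⟩ | ⟨c', hc', _, hg⟩ := h.shape hm
  · cases hk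
  · refine Relation.ReflTransGen.trans ?_ (hc' ▸ hg)
    refine (grows_lf_lf (show j ≤ m - 2 by omega) (by omega)).insert ?_
    simp [insertions, show ¬ m - 2 + 2 < m by omega]

theorem weight_lt_of_mem_insertions (hm : 2 ≤ m) {t t' : MTree m} (h : Grows m (lf 0) t)
    (ht : t' ∈ insertions t) : weight t < weight t' := by
  induction t generalizing t' with
  | lf j =>
    have hj := h.lf_le hm
    simp only [insertions] at ht
    obtain rfl := List.eq_of_mem_replicate ht
    split_ifs with hj2 <;> simp only [weight] <;> omega
  | nd c ih =>
    obtain ⟨i, s, hs, rfl⟩ := mem_insertions_nd.1 ht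
    simp only [weight]
    refine Nat.add_lt_add_left ?_ m
    refine Finset.sum_lt_sum (fun k _ => ?_) ⟨i, Finset.mem_univ i, ?_⟩
    · obtain rfl | hk := eq_or_ne k i
      · simpa using (ih k (h.child hm k) hs).le
      · simp [hk]
    · simpa using ih i (h.child hm i) hs

end Reachable

theorem weight_le_of_decompCount_ne_zero {m : ℕ} (hm : 0 < m) {S : Set (MTree m)}
    {T t : MTree m} (h : decompCount S T t ≠ 0) : weight T ≤ weight t := by
  induction t with
  | lf j =>
    simp only [decompCount, ne_eq, ite_eq_right_iff, not_forall] at h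
    obtain ⟨⟨_, rfl⟩, _⟩ := h
    exact le_rfl
  | nd c ih =>
    simp only [decompCount] at h
    split_ifs at h with h1 h2
    · exact h2 ▸ le_rfl
    · exact absurd rfl h
    · obtain ⟨i, _, hi⟩ := Finset.exists_ne_zero_of_sum_ne_zero h
      exact (ih i hi).trans (weight_child_lt hm c i).le

section Vectors

variable {m q : ℕ}

/-- The composition vector of the decomposition of a tree with respect to the types `τ`. -/
noncomputable def compVec (τ : Fin q → MTree m) (t : MTree m) : Fin q → ℝ :=
  fun i => decompCount (Set.range τ) (τ i) t

/-- The composition vector of the forest of children of the root. -/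
noncomputable def childVec (τ : Fin q → MTree m) : MTree m → Fin q → ℝ
  | lf _ => 0
  | nd c => ∑ i, compVec τ (c i)

/-- The difference between a tree and its children, in terms of composition vectors. -/
noncomputable def rootVec (τ : Fin q → MTree m) (t : MTree m) : Fin q → ℝ :=
  compVec τ t - childVec τ t

/-- The total change of the composition vector over all insertions of a key. -/
noncomputable def drift (τ : Fin q → MTree m) (t : MTree m) : Fin q → ℝ :=
  ((insertions t).map (compVec τ)).sum - (gaps t : ℝ) • compVec τ t

open Classical in
theorem compVec_apply_self {τ : Fin q → MTree m} (hinj : Function.Injective τ) (j : Fin q) :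
    compVec τ (τ j) = Pi.single j 1 := by
  ext i
  have hj : τ j ∈ Set.range τ := ⟨j, rfl⟩
  have key : decompCount (Set.range τ) (τ i) (τ j) = if τ j = τ i then 1 else 0 := by
    generalize τ j = t at hj
    cases t <;> simp [decompCount, Set.mem_range.1 hj]
  simp [compVec, key, Pi.single_apply, hinj.eq_iff, eq_comm]

theorem compVec_nd_of_notMem {τ : Fin q → MTree m} {c : Fin m → MTree m}
    (h : nd c ∉ Set.range τ) : compVec τ (nd c) = ∑ i, compVec τ (c i) := by
  ext i
  simp [compVec, decompCount, Set.mem_range.not.1 h]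

theorem intensity_mulVec_compVec_self {τ : Fin q → MTree m} (hinj : Function.Injective τ)
    (j : Fin q) : (intensity τ q le_rfl).mulVec (compVec τ (τ j)) = drift τ (τ j) := by
  have hsum (l : List (MTree m)) (i : Fin q) :
      (l.map (compVec τ)).sum i = (l.map fun t => compVec τ t i).sum := by
    induction l with
    | nil => rfl
    | cons a l ih => simp [ih]
  ext i
  simp [intensity, drift, hsum, compVec_apply_self hinj, compVec, Pi.single_apply]

theorem sum_childVec_insertions (τ : Fin q → MTree m) (c : Fin m → MTree m) :
    ((insertions (nd c)).map (childVec τ)).sum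
      = ∑ i, drift τ (c i) + (gaps (nd c) : ℝ) • childVec τ (nd c) := by
  have hupd (i : Fin m) (t : MTree m) : childVec τ (nd (Function.update c i t))
      = compVec τ t + (childVec τ (nd c) - compVec τ (c i)) := by
    simp only [childVec]
    rw [← Finset.add_sum_erase _ _ (Finset.mem_univ i),
      ← Finset.add_sum_erase _ (fun k => compVec τ (c k)) (Finset.mem_univ i)]
    simp only [Function.update_self, add_sub_cancel_left]
    congr 1
    refine Finset.sum_congr rfl fun k hk => ?_
    rw [Function.update_of_ne (Finset.ne_of_mem_erase hk)]
  rw [sum_map_insertions_nd]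
  simp only [hupd, List.sum_map_add, List.map_const', List.sum_replicate, length_insertions,
    drift, gaps, Nat.cast_sum, Finset.sum_smul, ← Finset.sum_add_distrib]
  refine Finset.sum_congr rfl fun i _ => ?_
  rw [← Nat.cast_smul_eq_nsmul ℝ, smul_sub]
  abel

end Vectors

open Classical in
theorem sum_count_smul {ι α M : Type*} [Fintype ι] [AddCommGroup M] [Module ℝ M]
    {τ : ι → α} (hinj : Function.Injective τ) (f : α → M) (l : List α)
    (hf : ∀ t ∈ l, t ∉ Set.range τ → f t = 0) :
    ∑ i, (l.count (τ i) : ℝ) • f (τ i) = (l.map f).sum := by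
  induction l with
  | nil => simp
  | cons a l ih =>
    have hsingle : ∑ i, (if a = τ i then (1 : ℝ) else 0) • f (τ i) = f a := by
      by_cases ha : a ∈ Set.range τ
      · obtain ⟨k, rfl⟩ := ha
        simp [hinj.eq_iff]
      · rw [hf a List.mem_cons_self ha]
        refine Finset.sum_eq_zero fun i _ => ?_
        rw [if_neg (fun h => ha ⟨i, h.symm⟩), zero_smul]
    rw [List.map_cons, List.sum_cons, ← ih fun t ht => hf t (List.mem_cons_of_mem a ht),
      ← hsingle, ← Finset.sum_add_distrib]
    refine Finset.sum_congr rfl fun i _ => ?_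
    rw [← add_smul, List.count_cons, add_comm]
    simp

theorem det_bidiagonal_add_corner {R : Type*} [CommRing R] (n : ℕ) (d s : ℕ → R) (c : R) :
    (Matrix.of fun i j : Fin (n + 1) =>
      (if i = j then d j else 0) + (if (i : ℕ) = j + 1 then s j else 0)
        + (if i = 0 ∧ j = Fin.last n then c else 0)).det
      = ∏ i ∈ Finset.range (n + 1), d i + (-1) ^ n * c * ∏ i ∈ Finset.range n, s i := by
  set M : Matrix (Fin (n + 1)) (Fin (n + 1)) R := Matrix.of fun i j : Fin (n + 1) =>
      (if i = j then d j else 0) + (if (i : ℕ) = j + 1 then s j else 0)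
        + (if i = 0 ∧ j = Fin.last n then c else 0) with hM
  have h0 (j : Fin (n + 1)) :
      M 0 j = (if j = 0 then d 0 else 0) + if j = Fin.last n then c else 0 := by
    simp only [hM, Matrix.of_apply, eq_comm (a := (0 : Fin (n + 1))), true_and, Fin.val_zero]
    by_cases hj : j = 0 <;> simp [hj]
  have hd : (M.submatrix Fin.succ (Fin.succAbove 0)).det = ∏ i ∈ Finset.range n, d (i + 1) := by
    rw [Matrix.det_of_isLowerTriangular, Finset.prod_range]
    · simp [hM]
    · intro i j hij
      have hij : i < j := hij
      simp [hM, Fin.succ_ne_zero, hij.ne, show (i : ℕ) ≠ j + 1 by omega]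
  have hs : (M.submatrix Fin.succ (Fin.succAbove (Fin.last n))).det
      = ∏ i ∈ Finset.range n, s i := by
    rw [Matrix.det_of_isUpperTriangular, Finset.prod_range]
    · simp [hM, Fin.castSucc_lt_succ.ne']
    · intro i j hij
      have hij : j < i := hij
      have hsucc : i.succ ≠ j.castSucc := fun h => by
        have := congrArg Fin.val h
        simp only [Fin.val_succ, Fin.val_castSucc] at this
        omega
      have hne : i ≠ j := hij.ne'
      simp [hM, Fin.succ_ne_zero, hsucc, Fin.val_inj, hne]
  rw [Matrix.det_succ_row_zero]
  simp only [h0, mul_add, add_mul, Finset.sum_add_distrib]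
  simp only [mul_ite, ite_mul, mul_zero, zero_mul, Finset.sum_ite_eq', Finset.mem_univ, if_true]
  rw [hd, hs, Finset.prod_range_succ']
  simp [mul_comm]

open Classical in
/-- The matrix of the intensity operator with respect to the vectors `rootVec τ (τ i)`. -/
noncomputable def rootMatrix {m q : ℕ} (τ : Fin q → MTree m) : Matrix (Fin q) (Fin q) ℝ :=
  Matrix.of fun i j =>
    ((insertions (τ j)).count (τ i) : ℝ) - (if i = j then (gaps (τ j) : ℝ) else 0)
      + (if τ i = lf 0 ∧ τ j = lf (m - 2) then ((m - 1 : ℝ) * m) else 0)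

/-- `τ` enumerates, compatibly with the growth order, a down-set of trees which contains all
trees with a single node. -/
structure IsTypeEnumeration {m q : ℕ} (τ : Fin q → MTree m) : Prop where
  injective : Function.Injective τ
  valid : ∀ i, Grows m (lf 0) (τ i)
  down : ∀ (a : MTree m) (i : Fin q), Grows m (lf 0) a → Grows m a (τ i) → a ∈ Set.range τ
  single : ∀ j, j ≤ m - 2 → lf j ∈ Set.range τ
  compat : ∀ i j : Fin q, Grows m (τ i) (τ j) → i ≤ j

namespace IsTypeEnumeration

variable {m q : ℕ} {τ : Fin q → MTree m}

theorem notMem_of_mem_insertions (hτ : IsTypeEnumeration τ) {t t' : MTree m}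
    (h : Grows m (lf 0) t) (ht : t ∉ Set.range τ) (ht' : t' ∈ insertions t) :
    t' ∉ Set.range τ := by
  rintro ⟨i, rfl⟩
  exact ht (hτ.down t i h (Relation.ReflTransGen.single ht'))

theorem rootVec_of_notMem (hτ : IsTypeEnumeration τ) (hm : 2 ≤ m) {t : MTree m}
    (h : Grows m (lf 0) t) (ht : t ∉ Set.range τ) : rootVec τ t = 0 := by
  cases t with
  | lf j =>
    have := h.lf_le hm
    exact absurd (hτ.single j (by omega)) ht
  | nd c => rw [rootVec, compVec_nd_of_notMem ht, childVec, sub_self]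

theorem intensity_mulVec_compVec (hτ : IsTypeEnumeration τ) (hm : 2 ≤ m) {t : MTree m}
    (h : Grows m (lf 0) t) : (intensity τ q le_rfl).mulVec (compVec τ t) = drift τ t := by
  induction t with
  | lf j =>
    have := h.lf_le hm
    obtain ⟨i, hi⟩ := hτ.single j (by omega)
    rw [← hi, intensity_mulVec_compVec_self hτ.injective]
  | nd c ih =>
    by_cases ht : nd c ∈ Set.range τ
    · obtain ⟨i, hi⟩ := ht
      rw [← hi, intensity_mulVec_compVec_self hτ.injective]
    · have hins : (insertions (nd c)).map (compVec τ)
          = (insertions (nd c)).map (childVec τ) :=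
        List.map_congr_left fun t' ht' => sub_eq_zero.1 <|
          hτ.rootVec_of_notMem hm (h.insert ht') (hτ.notMem_of_mem_insertions h ht ht')
      rw [drift, hins, sum_childVec_insertions, compVec_nd_of_notMem ht, childVec,
        add_sub_cancel_right, Matrix.mulVec_sum]
      exact Finset.sum_congr rfl fun i _ => ih i (h.child hm i)

theorem intensity_mulVec_rootVec_nd (hτ : IsTypeEnumeration τ) (hm : 2 ≤ m)
    {c : Fin m → MTree m} (h : Grows m (lf 0) (nd c)) :
    (intensity τ q le_rfl).mulVec (rootVec τ (nd c))
      = ((insertions (nd c)).map (rootVec τ)).sum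
        - (gaps (nd c) : ℝ) • rootVec τ (nd c) := by
  have hsplit : ((insertions (nd c)).map (compVec τ)).sum
      = ((insertions (nd c)).map (rootVec τ)).sum
        + ((insertions (nd c)).map (childVec τ)).sum := by
    rw [← List.sum_map_add]
    simp [rootVec]
  have hchild : (intensity τ q le_rfl).mulVec (childVec τ (nd c)) = ∑ i, drift τ (c i) := by
    rw [childVec, Matrix.mulVec_sum]
    exact Finset.sum_congr rfl fun i _ => hτ.intensity_mulVec_compVec hm (h.child hm i)
  rw [rootVec, Matrix.mulVec_sub, hτ.intensity_mulVec_compVec hm h, hchild, drift, hsplit,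
    sum_childVec_insertions, ← rootVec, rootVec, smul_sub]
  abel

theorem intensity_mulVec_rootVec_lf (hτ : IsTypeEnumeration τ) (hm : 2 ≤ m)
    {j : ℕ} (h : Grows m (lf 0) (lf j)) :
    (intensity τ q le_rfl).mulVec (rootVec τ (lf j))
      = ((insertions (lf j)).map (rootVec τ)).sum
        - (gaps (lf j : MTree m) : ℝ) • rootVec τ (lf j)
        + (if j + 2 = m then ((j + 1 : ℝ) * m) else 0) • rootVec τ (lf 0) := by
  have hj := h.lf_le hm
  have hlf (k : ℕ) : rootVec τ (lf k) = compVec τ (lf k) := sub_zero _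
  rw [hlf, hτ.intensity_mulVec_compVec hm h, drift]
  simp only [insertions, List.map_replicate, List.sum_replicate]
  by_cases hj2 : j + 2 < m
  · simp [hj2, hj2.ne, hlf]
  · obtain rfl : j + 2 = m := by omega
    simp [rootVec, childVec, ← Nat.cast_smul_eq_nsmul ℝ, smul_sub, mul_smul]
    abel

theorem intensity_mulVec_rootVec (hτ : IsTypeEnumeration τ) (hm : 2 ≤ m) (j : Fin q) :
    (intensity τ q le_rfl).mulVec (rootVec τ (τ j))
      = ∑ i, rootMatrix τ i j • rootVec τ (τ i) := by
  classical
  have hcount : ∑ i, ((insertions (τ j)).count (τ i) : ℝ) • rootVec τ (τ i)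
      = ((insertions (τ j)).map (rootVec τ)).sum :=
    sum_count_smul hτ.injective _ _ fun t ht =>
      hτ.rootVec_of_notMem hm ((hτ.valid j).insert ht)
  obtain ⟨z, hz⟩ := hτ.single 0 (Nat.zero_le _)
  have hcorner : ∑ i, (if τ i = lf 0 ∧ τ j = lf (m - 2) then ((m - 1 : ℝ) * m) else 0)
        • rootVec τ (τ i)
      = (if τ j = lf (m - 2) then ((m - 1 : ℝ) * m) else 0) • rootVec τ (lf 0) := by
    rw [Finset.sum_eq_single z]
    · simp [hz]
    · intro i _ hi
      simp [← hz, hτ.injective.eq_iff, hi]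
    · simp
  simp only [rootMatrix, Matrix.of_apply, add_smul, sub_smul, Finset.sum_add_distrib,
    Finset.sum_sub_distrib, hcount, hcorner]
  simp only [ite_smul, zero_smul, Finset.sum_ite_eq', Finset.mem_univ, if_true]
  have hj := hτ.valid j
  generalize τ j = t at hj
  cases t with
  | lf k =>
    have hk := hj.lf_le hm
    rw [hτ.intensity_mulVec_rootVec_lf hm hj]
    by_cases hkm : k + 2 = m
    · obtain rfl := hkm
      simp only [Nat.add_sub_cancel, if_true]
      congr 3
      push_cast
      ring
    · simp [hkm, show k ≠ m - 2 by omega]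
  | nd c =>
    rw [hτ.intensity_mulVec_rootVec_nd hm hj]
    simp

theorem rootVec_apply_self (hτ : IsTypeEnumeration τ) (hm : 2 ≤ m) {i j : Fin q}
    (hij : weight (τ j) ≤ weight (τ i)) :
    rootVec τ (τ j) i = if i = j then 1 else 0 := by
  have hchild : childVec τ (τ j) i = 0 := by
    generalize τ j = t at hij
    cases t with
    | lf k => rfl
    | nd c =>
      rw [childVec, Finset.sum_apply]
      refine Finset.sum_eq_zero fun k _ => ?_
      rw [compVec, Nat.cast_eq_zero]
      by_contra hne
      have := weight_le_of_decompCount_ne_zero (by omega) hne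
      have := weight_child_lt (by omega) c k
      omega
  rw [rootVec, Pi.sub_apply, hchild, compVec_apply_self hτ.injective, Pi.single_apply, sub_zero]

theorem det_rootVec (hτ : IsTypeEnumeration τ) (hm : 2 ≤ m) :
    (Matrix.of fun i j => rootVec τ (τ j) i).det = 1 := by
  have hblock : (Matrix.of fun i j => rootVec τ (τ j) i).BlockTriangular
      fun i => weight (τ i) := by
    intro i j hij
    have hij : weight (τ j) < weight (τ i) := hij
    have hne : i ≠ j := by
      rintro rfl
      exact lt_irrefl _ hij
    simp [hτ.rootVec_apply_self hm hij.le, hne]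
  rw [hblock.det]
  refine Finset.prod_eq_one fun w _ => ?_
  have hone : (Matrix.of fun i j => rootVec τ (τ j) i).toSquareBlock
      (fun i => weight (τ i)) w = 1 := by
    ext i j
    rw [Matrix.toSquareBlock_def, Matrix.of_apply, Matrix.of_apply,
      hτ.rootVec_apply_self hm (by rw [i.2, j.2]), Matrix.one_apply]
    simp only [Subtype.ext_iff]
  rw [hone, Matrix.det_one]

theorem charpoly_intensity (hτ : IsTypeEnumeration τ) (hm : 2 ≤ m) :
    (intensity τ q le_rfl).charpoly = (rootMatrix τ).charpoly := by
  set V : Matrix (Fin q) (Fin q) ℝ := Matrix.of fun i j => rootVec τ (τ j) i with hV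
  have hunit : IsUnit V := by
    rw [Matrix.isUnit_iff_isUnit_det, hτ.det_rootVec hm]
    exact isUnit_one
  obtain ⟨W, hW⟩ := hunit
  have hmul : intensity τ q le_rfl * V = V * rootMatrix τ := by
    ext i j
    have := congrFun (hτ.intensity_mulVec_rootVec hm j) i
    rw [Finset.sum_apply] at this
    rw [Matrix.mul_apply, Matrix.mul_apply]
    simpa [Matrix.mulVec, dotProduct, hV, mul_comm] using this
  rw [← Matrix.charpoly_units_conj W (rootMatrix τ), hW, ← hmul, ← hW, mul_assoc]
  simp

theorem apply_of_lt (hτ : IsTypeEnumeration τ) (hm : 2 ≤ m) (i : Fin q)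
    (hi : (i : ℕ) < m - 1) : τ i = lf i := by
  obtain ⟨n, hn⟩ := i
  induction n using Nat.strong_induction_on with
  | _ n ih =>
    simp only at hi ih ⊢
    obtain ⟨k, hk⟩ := hτ.single n (by omega)
    have hkn : ¬ (k : ℕ) < n := fun hlt => by
      have := hk.symm.trans (ih k hlt k.2 (by omega))
      cases this
      omega
    have hle (h : Grows m (lf n) (τ ⟨n, hn⟩)) : τ ⟨n, hn⟩ = lf n := by
      rw [← hk] at h
      have := Fin.le_def.1 (hτ.compat _ _ h)
      rw [← hk]
      congr 1
      ext
      simp only at this ⊢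
      omega
    have hv := hτ.valid ⟨n, hn⟩
    cases ht : τ ⟨n, hn⟩ with
    | lf l =>
      rw [ht] at hv
      obtain hl | hl := lt_or_ge l n
      · have := hτ.injective (ht.trans (ih l hl (by omega) (by omega)).symm)
        simp only [Fin.mk.injEq] at this
        omega
      · exact ht ▸ hle (ht ▸ grows_lf_lf hl (hv.lf_le hm))
    | nd c =>
      rw [ht] at hv
      exact ht ▸ hle (ht ▸ hv.lf_nd hm (by omega))

theorem sub_one_le (hτ : IsTypeEnumeration τ) (hm : 2 ≤ m) : m - 1 ≤ q := by
  obtain ⟨k, hk⟩ := hτ.single (m - 2) le_rfl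
  by_contra hlt
  have := hk.symm.trans (hτ.apply_of_lt hm k (by omega))
  rw [lf.injEq] at this
  omega

theorem exists_nd_of_le (hτ : IsTypeEnumeration τ) (hm : 2 ≤ m) (i : Fin q)
    (hi : m - 1 ≤ (i : ℕ)) : ∃ c, τ i = nd c := by
  have hv := hτ.valid i
  cases ht : τ i with
  | lf j =>
    rw [ht] at hv
    have hj := hv.lf_le hm
    have := hτ.injective (ht.trans (hτ.apply_of_lt hm ⟨j, by omega⟩ (by simp; omega)).symm)
    simp [Fin.ext_iff] at this
    omega
  | nd c => exact ⟨c, rfl⟩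

theorem rootMatrix_eq_zero (hτ : IsTypeEnumeration τ) (hm : 2 ≤ m) {i j : Fin q} (hij : i < j)
    (hj : m - 1 ≤ (j : ℕ)) : rootMatrix τ i j = 0 := by
  classical
  obtain ⟨c, hc⟩ := hτ.exists_nd_of_le hm j hj
  have hcount : τ i ∉ insertions (τ j) := fun h =>
    (hτ.compat j i (Relation.ReflTransGen.single h)).not_gt hij
  rw [rootMatrix, Matrix.of_apply, List.count_eq_zero_of_not_mem hcount]
  simp [hij.ne, hc]

theorem rootMatrix_self (hτ : IsTypeEnumeration τ) (hm : 2 ≤ m) {i : Fin q}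
    (hi : m - 1 ≤ (i : ℕ)) : rootMatrix τ i i = -gaps (τ i) := by
  classical
  obtain ⟨c, hc⟩ := hτ.exists_nd_of_le hm i hi
  have hcount : τ i ∉ insertions (τ i) := fun h =>
    lt_irrefl _ (weight_lt_of_mem_insertions hm (hτ.valid i) h)
  rw [rootMatrix, Matrix.of_apply, List.count_eq_zero_of_not_mem hcount]
  simp [hc]

theorem rootMatrix_of_lt {n : ℕ} {τ : Fin q → MTree (n + 2)} (hτ : IsTypeEnumeration τ)
    {i j : Fin q} (hi : (i : ℕ) < n + 1) (hj : (j : ℕ) < n + 1) :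
    rootMatrix τ i j = (if i = j then -((j : ℝ) + 1) else 0)
      + (if (i : ℕ) = j + 1 then (j : ℝ) + 1 else 0)
      + (if (i : ℕ) = 0 ∧ (j : ℕ) = n then ((n : ℝ) + 1) * (n + 2) else 0) := by
  classical
  have hlf (k : Fin q) (hk : (k : ℕ) < n + 1) : τ k = lf k := hτ.apply_of_lt (by omega) k hk
  have hcount : (insertions (τ j)).count (τ i) = if (i : ℕ) = j + 1 then (j : ℕ) + 1 else 0 := by
    rw [hlf i hi, hlf j hj, insertions, List.count_replicate]
    by_cases hjn : (j : ℕ) < n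
    · simp [hjn, eq_comm (a := (i : ℕ))]
    · simp [hjn, show (i : ℕ) ≠ j + 1 by omega]
  rw [rootMatrix, Matrix.of_apply, hcount]
  simp only [hlf i hi, hlf j hj, gaps, lf.injEq, Nat.add_sub_cancel]
  push_cast
  split_ifs <;> ring

theorem det_charmatrix_toSquareBlockProp_lt {n : ℕ} {τ : Fin q → MTree (n + 2)}
    (hτ : IsTypeEnumeration τ) :
    (((rootMatrix τ).charmatrix).toSquareBlockProp fun i : Fin q => (i : ℕ) < n + 1).det
      = (∏ i ∈ Finset.range (n + 1), (X + C ((i : ℝ) + 1))) - C ((n + 2).factorial : ℝ) := by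
  have hq : n + 1 ≤ q := hτ.sub_one_le (by omega)
  let e : Fin (n + 1) ≃ {i : Fin q // (i : ℕ) < n + 1} :=
    { toFun := fun i => ⟨⟨i, by omega⟩, i.2⟩
      invFun := fun i => ⟨i.1, i.2⟩
      left_inv := fun _ => rfl
      right_inv := fun _ => rfl }
  have hfact : ∏ i ∈ Finset.range n, ((i : ℝ) + 1) = n.factorial := by
    rw [← Finset.prod_range_add_one_eq_factorial]
    push_cast
    rfl
  have hmat : (((rootMatrix τ).charmatrix).toSquareBlockProp
        fun i : Fin q => (i : ℕ) < n + 1).submatrix e e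
      = Matrix.of fun i j : Fin (n + 1) =>
        (if i = j then (fun k : ℕ => X + C ((k : ℝ) + 1)) j else 0)
          + (if (i : ℕ) = j + 1 then (fun k : ℕ => -C ((k : ℝ) + 1)) j else 0)
          + (if i = 0 ∧ j = Fin.last n then -C (((n : ℝ) + 1) * (n + 2)) else 0) := by
    ext1 i j
    rw [Matrix.submatrix_apply, Matrix.toSquareBlockProp_def, Matrix.of_apply, Matrix.of_apply,
      Matrix.charmatrix_apply, hτ.rootMatrix_of_lt (e i).2 (e j).2, Matrix.diagonal_apply]
    simp only [e, Equiv.coe_fn_mk, Fin.ext_iff, Fin.val_zero, Fin.val_last, map_add, apply_ite C,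
      map_neg, map_zero]
    split_ifs <;> ring
  rw [← Matrix.det_submatrix_equiv_self e, hmat,
    det_bidiagonal_add_corner n (fun k => X + C ((k : ℝ) + 1)) (fun k => -C ((k : ℝ) + 1)),
    Finset.prod_neg, Finset.card_range, ← map_prod, hfact, sub_eq_add_neg]
  congr 1
  have hsign : ((-1 : ℝ[X]) ^ n) * (-1) ^ n = 1 := by rw [← mul_pow]; simp
  have hC : C (((n + 2).factorial : ℕ) : ℝ)
      = C (((n : ℝ) + 1) * (n + 2)) * C (n.factorial : ℝ) := by
    rw [← C_mul]
    congr 1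
    push_cast [Nat.factorial_succ]
    ring
  rw [hC]
  linear_combination -(C (((n : ℝ) + 1) * (n + 2)) * C (n.factorial : ℝ)) * hsign

theorem det_charmatrix_toSquareBlockProp_not_lt (hτ : IsTypeEnumeration τ) (hm : 2 ≤ m) :
    (((rootMatrix τ).charmatrix).toSquareBlockProp fun i : Fin q => ¬ (i : ℕ) < m - 1).det
      = ∏ i ∈ Finset.univ.filter (fun i : Fin q => m - 1 ≤ (i : ℕ)),
          (X + C (gaps (τ i) : ℝ)) := by
  rw [Matrix.det_of_isLowerTriangular]
  · rw [Finset.prod_subtype (p := fun i : Fin q => ¬ (i : ℕ) < m - 1) _ (by simp)]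
    refine Finset.prod_congr rfl fun i _ => ?_
    rw [Matrix.toSquareBlockProp_def, Matrix.of_apply, Matrix.charmatrix_apply_eq,
      hτ.rootMatrix_self hm (not_lt.1 i.2), map_neg, sub_neg_eq_add]
  · intro i j hij
    have hij : i.1 < j.1 := hij
    rw [Matrix.toSquareBlockProp_def, Matrix.of_apply, Matrix.charmatrix_apply_ne _ _ _ hij.ne,
      hτ.rootMatrix_eq_zero hm hij (not_lt.1 j.2), map_zero, neg_zero]

end IsTypeEnumeration

/-- **Theorem (eigenvalues of the intensity matrix of the fringe-subtree urn for
`m`-ary search trees).** Let `m ≥ 2` and let `A = A_q` be the intensity matrix of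
the Pólya urn with the full type set `𝒮` (a down-set of `m`-ary search trees
containing all single-node trees, enumerated compatibly with `⪯` by `τ`, so that
`T_i` for `i ≤ m − 1` is a single node with `i − 1` keys and activity `i`). Then
the eigenvalues of `A`, counted with algebraic multiplicity, are the `m − 1` roots
of `φ_m(λ) = Π_{i=1}^{m−1}(λ + i) − m!` together with the multiset
`{−a_i : i = m, …, q}` (stated as a factorization of the characteristic
polynomial). -/
theorem intensity_eigenvalues (m q : ℕ) (hm : 2 ≤ m) (τ : Fin q → MTree m)
    (hinj : Function.Injective τ)
    (hvalid : ∀ i, Grows m (MTree.lf 0) (τ i))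
    (hdown : ∀ (a : MTree m) (i : Fin q),
      Grows m (MTree.lf 0) a → Grows m a (τ i) → a ∈ Set.range τ)
    (hsingle : ∀ j, j ≤ m - 2 → MTree.lf j ∈ Set.range τ)
    (hcompat : ∀ i j : Fin q, Grows m (τ i) (τ j) → i ≤ j) :
    (intensity τ q le_rfl).charpoly
      = ((∏ i ∈ Finset.range (m - 1), (X + C (((i : ℕ) : ℝ) + 1)))
            - C ((Nat.factorial m : ℝ)))
        * ∏ i ∈ Finset.univ.filter (fun i : Fin q => m - 1 ≤ (i : ℕ)),
            (X + C ((MTree.gaps (τ i) : ℝ))) := by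
  have hτ : IsTypeEnumeration τ := ⟨hinj, hvalid, hdown, hsingle, hcompat⟩
  obtain ⟨n, rfl⟩ := Nat.exists_eq_add_of_le' hm
  rw [hτ.charpoly_intensity hm, Matrix.charpoly,
    Matrix.twoBlockTriangular_det' _ (fun i : Fin q => (i : ℕ) < n + 2 - 1),
    hτ.det_charmatrix_toSquareBlockProp_not_lt hm]
  · exact congrArg (· * _) hτ.det_charmatrix_toSquareBlockProp_lt
  · intro i hi j hj
    have hij : i < j := Fin.lt_def.2 (by omega)
    rw [Matrix.charmatrix_apply_ne _ _ _ hij.ne,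
      hτ.rootMatrix_eq_zero hm hij (not_lt.1 hj), map_zero, neg_zero]

end UrnMST
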